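/- Let f : [a,b] → ℝ be a regulated function with 1 < p < ∞, and suppose σ_p(f) := ∑_{t ∈ (a,b]} |f(t) - f(t-)|^p + ∑_{t ∈ [a,b)} |f(t+) - f(t)|^p < ∞. Then for every partition κ of [a,b] and every ε > 0 there exists a refinement λ ⊇ κ of κ such that s_p(f;λ) ≤ σ_p(f) + ε. Consequently sup_κ inf_{λ ⊇ κ} s_p(f;λ) = σ_p(f). -/

import Mathlib

open Function Set Filter Topology

/-- The sum `s_p(f;S)` of `p`-th powers of increments of `f` along the finite partition
set `S`, listed in increasing order. -/
noncomputable def partSum (p : ℝ) (f : ℝ → ℝ) (S : Finset ℝ) : ℝ :=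
  ∑ i ∈ Finset.range ((S.sort (· ≤ ·)).length - 1),
    |f ((S.sort (· ≤ ·)).getD (i + 1) 0) - f ((S.sort (· ≤ ·)).getD i 0)| ^ p

/-- A finite subset of `[a,b]` containing both endpoints, regarded as a partition of `[a,b]`. -/
def IsPartition (a b : ℝ) (S : Finset ℝ) : Prop :=
  a ∈ S ∧ b ∈ S ∧ ↑S ⊆ Set.Icc a b

/-- The sum of `g` over pairs of consecutive elements of `S`. -/
noncomputable def chainSum (g : ℝ → ℝ → ℝ) (S : Finset ℝ) : ℝ :=
  ∑ i ∈ Finset.range ((S.sort (· ≤ ·)).length - 1),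
    g ((S.sort (· ≤ ·)).getD i 0) ((S.sort (· ≤ ·)).getD (i + 1) 0)

theorem partSum_eq_chainSum (p : ℝ) (f : ℝ → ℝ) (S : Finset ℝ) :
    partSum p f S = chainSum (fun u v => |f v - f u| ^ p) S := rfl

theorem chainSum_nonneg {g : ℝ → ℝ → ℝ} (hg : ∀ u v, 0 ≤ g u v) (S : Finset ℝ) :
    0 ≤ chainSum g S :=
  Finset.sum_nonneg fun _ _ => hg _ _

@[simp] theorem chainSum_singleton (g : ℝ → ℝ → ℝ) (x : ℝ) : chainSum g {x} = 0 := by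
  simp [chainSum]

theorem IsPartition.le {a b : ℝ} {S : Finset ℝ} (h : IsPartition a b S) : a ≤ b :=
  (h.2.2 h.1).2

theorem IsPartition.singleton (b : ℝ) : IsPartition b b {b} := by
  simp [IsPartition]

theorem IsPartition.insert_lt {x m b : ℝ} {S : Finset ℝ} (h : IsPartition m b S) (hx : x < m) :
    IsPartition x b (insert x S) := by
  refine ⟨by simp, by simp [h.2.1], fun y hy => ?_⟩
  rcases Finset.mem_insert.1 hy with rfl | hy
  · exact ⟨le_rfl, hx.le.trans h.le⟩
  · exact ⟨hx.le.trans (h.2.2 hy).1, (h.2.2 hy).2⟩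

theorem IsPartition.pair {a b : ℝ} (h : a < b) : IsPartition a b {a, b} :=
  (IsPartition.singleton b).insert_lt h

theorem IsPartition.union {a c b : ℝ} {S T : Finset ℝ} (hS : IsPartition a c S)
    (hT : IsPartition c b T) : IsPartition a b (S ∪ T) := by
  refine ⟨by simp [hS.1], by simp [hT.2.1], fun y hy => ?_⟩
  rcases Finset.mem_union.1 hy with hy | hy
  · exact ⟨(hS.2.2 hy).1, (hS.2.2 hy).2.trans hT.le⟩
  · exact ⟨hS.le.trans (hT.2.2 hy).1, (hT.2.2 hy).2⟩

theorem chainSum_insert (g : ℝ → ℝ → ℝ) {x m b : ℝ} {S : Finset ℝ} (hS : IsPartition m b S)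
    (hx : x < m) : chainSum g (insert x S) = g x m + chainSum g S := by
  have h1 : ∀ y ∈ S, x ≤ y := fun y hy => hx.le.trans (hS.2.2 hy).1
  have h2 : x ∉ S := fun h => absurd (hS.2.2 h).1 (not_le.2 hx)
  have h3 : ∃ l, S.sort (· ≤ ·) = m :: l := by
    have e : S = insert m (S.erase m) := (Finset.insert_erase hS.1).symm
    refine ⟨(S.erase m).sort (· ≤ ·), ?_⟩
    conv_lhs => rw [e]
    exact Finset.sort_insert (r := (· ≤ ·))
      (fun y hy => (hS.2.2 (Finset.mem_of_mem_erase hy)).1) (by simp)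
  obtain ⟨l, hl⟩ := h3
  have h4 : (insert x S).sort (· ≤ ·) = x :: m :: l := by
    rw [Finset.sort_insert (r := (· ≤ ·)) h1 h2, hl]
  simp [chainSum, h4, hl, Finset.sum_range_succ', add_comm]

theorem IsPartition.induction {b : ℝ} {P : ℝ → Finset ℝ → Prop} (base : P b {b})
    (step : ∀ x m S, x < m → IsPartition m b S → P m S → P x (insert x S))
    {a : ℝ} {S : Finset ℝ} (h : IsPartition a b S) : P a S := by
  induction S using Finset.induction_on_min generalizing a with
  | empty => simp [IsPartition] at h
  | insert x S hx ih =>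
    have hxa : x = a := by
      have h1 := (h.2.2 (Finset.mem_insert_self x S)).1
      rcases Finset.mem_insert.1 h.1 with h2 | h2
      · exact h2.symm
      · exact absurd (hx _ h2) (not_lt.2 h1)
    subst hxa
    rcases S.eq_empty_or_nonempty with rfl | hne
    · have : b = x := by simpa using h.2.1
      subst this
      simpa using base
    · have hbS : b ∈ S := by
        rcases Finset.mem_insert.1 h.2.1 with h2 | h2
        · obtain ⟨y, hy⟩ := hne
          have h3 := (h.2.2 (Finset.mem_insert_of_mem hy)).2
          exact absurd (hx y hy) (not_lt.2 (h2 ▸ h3))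
        · exact h2
      have hm : IsPartition (S.min' hne) b S :=
        ⟨S.min'_mem hne, hbS, fun y hy =>
          ⟨S.min'_le y hy, (h.2.2 (Finset.mem_insert_of_mem hy)).2⟩⟩
      exact step x _ S (hx _ (S.min'_mem hne)) hm (ih hm)

theorem chainSum_union (g : ℝ → ℝ → ℝ) {a c b : ℝ} {S T : Finset ℝ} (hS : IsPartition a c S)
    (hT : IsPartition c b T) : chainSum g (S ∪ T) = chainSum g S + chainSum g T := by
  refine hS.induction (P := fun _ S => chainSum g (S ∪ T) = chainSum g S + chainSum g T) ?_ ?_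
  · rw [Finset.singleton_union, Finset.insert_eq_of_mem hT.1]
    simp
  · intro x m S hx hS ih
    rw [Finset.insert_union, chainSum_insert g (hS.union hT) hx, chainSum_insert g hS hx, ih]
    ring

theorem chainSum_add_right_left (φ ψ : ℝ → ℝ) {a b : ℝ} {S : Finset ℝ} (hS : IsPartition a b S) :
    chainSum (fun u v => φ u + ψ v) S = ∑ t ∈ S, (φ t + ψ t) - ψ a - φ b := by
  refine hS.induction (P := fun a S =>
    chainSum (fun u v => φ u + ψ v) S = ∑ t ∈ S, (φ t + ψ t) - ψ a - φ b) ?_ ?_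
  · simp
  · intro x m S hx hS ih
    have h2 : x ∉ S := fun h => absurd (hS.2.2 h).1 (not_le.2 hx)
    rw [chainSum_insert _ hS hx, ih, Finset.sum_insert h2]
    ring

theorem chainSum_le_chainSum {g g' : ℝ → ℝ → ℝ} {a b : ℝ} {S : Finset ℝ}
    (hS : IsPartition a b S)
    (h : ∀ u ∈ S, ∀ v ∈ S, u < v → (∀ w ∈ S, w ∉ Ioo u v) → g u v ≤ g' u v) :
    chainSum g S ≤ chainSum g' S := by
  revert h
  refine hS.induction (P := fun _ S =>
    (∀ u ∈ S, ∀ v ∈ S, u < v → (∀ w ∈ S, w ∉ Ioo u v) → g u v ≤ g' u v) →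
    chainSum g S ≤ chainSum g' S) ?_ ?_
  · simp
  · intro x m S hx hS ih h
    rw [chainSum_insert g hS hx, chainSum_insert g' hS hx]
    refine add_le_add (h x (by simp) m (by simp [hS.1]) hx ?_) (ih ?_)
    · intro w hw hw'
      rcases Finset.mem_insert.1 hw with rfl | hw
      · exact lt_irrefl _ hw'.1
      · exact absurd (hS.2.2 hw).1 (not_le.2 hw'.2)
    · intro u hu v hv huv hc
      refine h u (by simp [hu]) v (by simp [hv]) huv ?_
      intro w hw hw'
      rcases Finset.mem_insert.1 hw with rfl | hw
      · exact absurd (hx.le.trans (hS.2.2 hu).1) (not_le.2 hw'.1)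
      · exact hc w hw hw'

theorem exists_last_step_le_chainSum {g : ℝ → ℝ → ℝ} (hg : ∀ u v, 0 ≤ g u v) {a b y : ℝ}
    {S : Finset ℝ} (hS : IsPartition a b S) (hy : y ∈ S) (hyb : y < b) :
    ∃ w ∈ Ico y b, g w b ≤ chainSum g S := by
  suffices H : ∀ y, y ∈ S → y < b → ∃ w ∈ Ico y b, g w b ≤ chainSum g S from H y hy hyb
  clear hy hyb y
  refine hS.induction (P := fun _ S => ∀ y, y ∈ S → y < b →
    ∃ w ∈ Ico y b, g w b ≤ chainSum g S) ?_ ?_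
  · intro y hy hyb
    simp at hy
    exact absurd hy hyb.ne
  · intro x m S hx hS ih y hy hyb
    rw [chainSum_insert g hS hx]
    have key : ∀ z ∈ S, z < b → y ≤ z →
        ∃ w ∈ Ico y b, g w b ≤ g x m + chainSum g S := by
      intro z hz hzb hyz
      obtain ⟨w, hw, hle⟩ := ih z hz hzb
      exact ⟨w, ⟨hyz.trans hw.1, hw.2⟩, by linarith [hg x m]⟩
    rcases Finset.mem_insert.1 hy with rfl | hy
    · rcases hS.le.lt_or_eq with hm | rfl
      · exact key m hS.1 hm hx.le
      · exact ⟨y, ⟨le_rfl, hyb⟩, by linarith [chainSum_nonneg hg S]⟩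
    · exact key y hy hyb le_rfl

theorem exists_first_step_eq_chainSum (g : ℝ → ℝ → ℝ) {a b : ℝ} {S : Finset ℝ}
    (hS : IsPartition a b S) (hab : a < b) :
    ∃ m T, a < m ∧ IsPartition m b T ∧ S = insert a T ∧
      chainSum g S = g a m + chainSum g T := by
  revert hab
  refine hS.induction (P := fun a S => a < b → ∃ m T, a < m ∧ IsPartition m b T ∧
    S = insert a T ∧ chainSum g S = g a m + chainSum g T) ?_ ?_
  · intro h
    exact absurd h (lt_irrefl _)
  · intro x m S hx hS _ _
    exact ⟨m, S, hx, hS, rfl, chainSum_insert g hS hx⟩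

/-- Refinements of the cells of a partition can be glued, for upper bounds. -/
theorem exists_refinement_chainSum_le {g g' : ℝ → ℝ → ℝ} {a b : ℝ}
    (hcell : ∀ u v, a ≤ u → u < v → v ≤ b → ∃ T, IsPartition u v T ∧ chainSum g T ≤ g' u v)
    {S : Finset ℝ} (hS : IsPartition a b S) :
    ∃ T, IsPartition a b T ∧ S ⊆ T ∧ chainSum g T ≤ chainSum g' S := by
  refine hS.induction (P := fun x S => a ≤ x →
    ∃ T, IsPartition x b T ∧ S ⊆ T ∧ chainSum g T ≤ chainSum g' S) ?_ ?_ le_rfl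
  · intro _
    exact ⟨{b}, .singleton b, le_rfl, by simp⟩
  · intro x m S hx hS ih hax
    obtain ⟨T, hT, hST, hle⟩ := ih (hax.trans hx.le)
    obtain ⟨T', hT', hcell_le⟩ := hcell x m hax hx hS.le
    refine ⟨T' ∪ T, hT'.union hT, ?_, ?_⟩
    · exact Finset.insert_subset (by simp [hT'.1]) (hST.trans Finset.subset_union_right)
    · rw [chainSum_union g hT' hT, chainSum_insert g' hS hx]
      exact add_le_add hcell_le hle

/-- Refinements of the cells of a partition can be glued, for lower bounds valid for all
further refinements. -/
theorem exists_refinement_le_chainSum {g g' : ℝ → ℝ → ℝ} {a b : ℝ}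
    (hcell : ∀ u v, a ≤ u → u < v → v ≤ b → ∃ K, IsPartition u v K ∧
      ∀ T, IsPartition u v T → K ⊆ T → g' u v ≤ chainSum g T)
    {S : Finset ℝ} (hS : IsPartition a b S) :
    ∃ K, IsPartition a b K ∧
      ∀ T, IsPartition a b T → K ⊆ T → chainSum g' S ≤ chainSum g T := by
  refine hS.induction (P := fun x S => a ≤ x → ∃ K, IsPartition x b K ∧
      ∀ T, IsPartition x b T → K ⊆ T → chainSum g' S ≤ chainSum g T) ?_ ?_ le_rfl
  · intro _
    refine ⟨{b}, .singleton b, fun T hT _ => ?_⟩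
    have : T = {b} := by
      ext y
      simp only [Finset.mem_singleton]
      refine ⟨fun hy => ?_, fun hy => hy ▸ hT.1⟩
      have := hT.2.2 hy
      exact le_antisymm this.2 this.1
    simp [this]
  · intro x m S hx hS ih hax
    obtain ⟨K, hK, hle⟩ := ih (hax.trans hx.le)
    obtain ⟨K', hK', hle'⟩ := hcell x m hax hx hS.le
    refine ⟨K' ∪ K, hK'.union hK, fun T hT hKT => ?_⟩
    have hmT : m ∈ T := hKT (by simp [hK.1])
    have h1 : IsPartition x m (T.filter (· ≤ m)) :=
      ⟨by simp [hT.1, hx.le], by simp [hmT], fun y hy => by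
        simp only [Finset.coe_filter, Set.mem_ofPred_eq] at hy
        exact ⟨(hT.2.2 hy.1).1, hy.2⟩⟩
    have h2 : IsPartition m b (T.filter (m ≤ ·)) :=
      ⟨by simp [hmT], by simp [hT.2.1, hS.le], fun y hy => by
        simp only [Finset.coe_filter, Set.mem_ofPred_eq] at hy
        exact ⟨hy.2, (hT.2.2 hy.1).2⟩⟩
    have h3 : T = T.filter (· ≤ m) ∪ T.filter (m ≤ ·) := by
      ext y
      simp only [Finset.mem_union, Finset.mem_filter]
      have := le_total y m
      tauto
    rw [h3, chainSum_union g h1 h2, chainSum_insert g' hS hx]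
    refine add_le_add (hle' _ h1 fun y hy => ?_) (hle _ h2 fun y hy => ?_)
    · exact Finset.mem_filter.2 ⟨hKT (by simp [hy]), (hK'.2.2 hy).2⟩
    · exact Finset.mem_filter.2 ⟨hKT (by simp [hy]), (hK.2.2 hy).1⟩

/-- The last passage of a regulated function below the level `y` misses `y` by at most a jump. -/
theorem abs_sub_rpow_le_at_last_passage {f W : ℝ → ℝ} {c d p y : ℝ} (hcd : c ≤ d) (hp : 0 < p)
    (hW : ∀ t, 0 ≤ W t)
    (hL : ∀ t ∈ Ioc c d, ∃ l, Tendsto f (𝓝[<] t) (𝓝 l) ∧ |f t - l| ^ p ≤ W t)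
    (hR : ∀ t ∈ Ico c d, ∃ r, Tendsto f (𝓝[>] t) (𝓝 r) ∧ |r - f t| ^ p ≤ W t)
    (hc : f c ≤ y) (hd : y ≤ f d) :
    |f (sSup {t ∈ Icc c d | f t ≤ y}) - y| ^ p ≤ W (sSup {t ∈ Icc c d | f t ≤ y}) := by
  set A := {t ∈ Icc c d | f t ≤ y} with hA
  set τ := sSup A with hτ
  have hcA : c ∈ A := ⟨⟨le_rfl, hcd⟩, hc⟩
  have hbdd : BddAbove A := ⟨d, fun t ht => ht.1.2⟩
  have hcτ : c ≤ τ := le_csSup hbdd hcA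
  have hτd : τ ≤ d := csSup_le ⟨c, hcA⟩ fun t ht => ht.1.2
  rcases le_or_gt (f τ) y with h | h
  · rcases hτd.lt_or_eq with h1 | h1
    · obtain ⟨r, hr, hle⟩ := hR τ ⟨hcτ, h1⟩
      have hyr : y ≤ r := by
        refine ge_of_tendsto hr ?_
        filter_upwards [Ioo_mem_nhdsGT h1] with t ht
        by_contra! hlt
        exact absurd (le_csSup hbdd ⟨⟨hcτ.trans ht.1.le, ht.2.le⟩, hlt.le⟩) (not_le.2 ht.1)
      refine le_trans (Real.rpow_le_rpow (abs_nonneg _) ?_ hp.le) hle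
      rw [abs_of_nonpos (by linarith), abs_of_nonneg (by linarith)]
      linarith
    · have : f τ = y := le_antisymm h (h1 ▸ hd)
      simp [this, Real.zero_rpow hp.ne', hW]
  · have hcτ' : c < τ := lt_of_le_of_ne hcτ fun e => absurd hc (not_le.2 (e ▸ h))
    obtain ⟨l, hl, hle⟩ := hL τ ⟨hcτ', hτd⟩
    have hly : l ≤ y := by
      by_contra! hlt
      obtain ⟨s, hs, hs'⟩ := (mem_nhdsLT_iff_exists_Ioo_subset).1 (hl.eventually (lt_mem_nhds hlt))
      obtain ⟨t, ht, hst⟩ := exists_lt_of_lt_csSup ⟨c, hcA⟩ hs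
      have htτ : t < τ := lt_of_le_of_ne (le_csSup hbdd ht) fun e =>
        absurd ht.2 (not_le.2 (e ▸ h))
      exact absurd ht.2 (not_le.2 (hs' ⟨hst, htτ⟩))
    refine le_trans (Real.rpow_le_rpow (abs_nonneg _) ?_ hp.le) hle
    rw [abs_of_nonneg (by linarith), abs_of_nonneg (by linarith)]
    linarith

theorem add_add_rpow_le {x y z p : ℝ} (hx : 0 ≤ x) (hy : 0 ≤ y) (hz : 0 ≤ z) (hp : 0 ≤ p) :
    (x + y + z) ^ p ≤ 3 ^ p * (x ^ p + y ^ p + z ^ p) := by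
  have hx' := Real.rpow_nonneg hx p
  have hy' := Real.rpow_nonneg hy p
  have hz' := Real.rpow_nonneg hz p
  have key : ∀ m, 0 ≤ m → x ≤ m → y ≤ m → z ≤ m → (x + y + z) ^ p ≤ 3 ^ p * m ^ p := by
    intro m hm h1 h2 h3
    rw [← Real.mul_rpow (by norm_num) hm]
    exact Real.rpow_le_rpow (by positivity) (by linarith) hp
  have h3 : (0 : ℝ) ≤ 3 ^ p := by positivity
  rcases le_total x y with h | h <;> rcases le_total y z with h' | h' <;>
    rcases le_total x z with h'' | h''
  all_goals
    first
    | exact (key x hx (by linarith) (by linarith) (by linarith)).trans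
        (mul_le_mul_of_nonneg_left (by linarith) h3)
    | exact (key y hy (by linarith) (by linarith) (by linarith)).trans
        (mul_le_mul_of_nonneg_left (by linarith) h3)
    | exact (key z hz (by linarith) (by linarith) (by linarith)).trans
        (mul_le_mul_of_nonneg_left (by linarith) h3)

theorem exists_nat_add_one_mul_div_rpow_le {p D ε : ℝ} (hp : 1 < p) (hD : 0 ≤ D) (hε : 0 < ε) :
    ∃ n : ℕ, 0 < n ∧ ((n : ℝ) + 1) * (D / n) ^ p ≤ ε := by
  have h1 : Tendsto (fun n : ℕ => 2 * D ^ p * (n : ℝ) ^ (-(p - 1))) atTop (𝓝 0) := by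
    have := ((tendsto_rpow_neg_atTop (sub_pos.2 hp)).comp
      tendsto_natCast_atTop_atTop).const_mul (2 * D ^ p)
    simpa using this
  obtain ⟨n, hn, hn0⟩ := ((h1.eventually (gt_mem_nhds hε)).and (eventually_gt_atTop 0)).exists
  refine ⟨n, hn0, le_trans ?_ hn.le⟩
  have hn' : (1 : ℝ) ≤ n := by exact_mod_cast hn0
  have hpos : (0 : ℝ) < n := by linarith
  have e : (n : ℝ) ^ (-(p - 1)) = n / (n : ℝ) ^ p := by
    rw [neg_sub, Real.rpow_sub hpos, Real.rpow_one]
  rw [e, Real.div_rpow hD hpos.le]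
  have h0 : 0 ≤ D ^ p / (n : ℝ) ^ p := by positivity
  calc ((n : ℝ) + 1) * (D ^ p / (n : ℝ) ^ p) ≤ (2 * n) * (D ^ p / (n : ℝ) ^ p) :=
        mul_le_mul_of_nonneg_right (by linarith) h0
    _ = _ := by ring

/-- A regulated function with `f c ≤ f d` has partitions whose `p`-variation sum is controlled
by the `p`-th powers of the jumps. -/
theorem exists_partition_partSum_le_of_le {f W : ℝ → ℝ} {c d p M ε : ℝ} (hcd : c ≤ d)
    (hp : 1 < p) (hW : ∀ t, 0 ≤ W t)
    (hL : ∀ t ∈ Ioc c d, ∃ l, Tendsto f (𝓝[<] t) (𝓝 l) ∧ |f t - l| ^ p ≤ W t)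
    (hR : ∀ t ∈ Ico c d, ∃ r, Tendsto f (𝓝[>] t) (𝓝 r) ∧ |r - f t| ^ p ≤ W t)
    (hM : ∀ A : Finset ℝ, ↑A ⊆ Icc c d → ∑ t ∈ A, W t ≤ M) (hε : 0 < ε) (hf : f c ≤ f d) :
    ∃ S, IsPartition c d S ∧ partSum p f S ≤ 2 * 3 ^ p * M + ε := by
  have hp0 : 0 < p := by linarith
  have h3 : (0 : ℝ) < 3 ^ p := by positivity
  obtain ⟨n, hn, hnε⟩ := exists_nat_add_one_mul_div_rpow_le hp (sub_nonneg.2 hf)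
    (div_pos hε h3)
  set h := (f d - f c) / n with hh
  have hn' : (0 : ℝ) < n := by exact_mod_cast hn
  have h0 : 0 ≤ h := div_nonneg (sub_nonneg.2 hf) hn'.le
  have hnh : n * h = f d - f c := by rw [hh]; field_simp
  set y : ℕ → ℝ := fun i => f c + i * h with hy
  set τ : ℕ → ℝ := fun i => if i = 0 then c else sSup {t ∈ Icc c d | f t ≤ y i} with hτ
  have hyc : ∀ i, f c ≤ y i := fun i => by
    have : 0 ≤ (i : ℝ) * h := by positivity
    simp only [hy]; linarith
  have hyd : ∀ i ≤ n, y i ≤ f d := fun i hi => by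
    have : (i : ℝ) * h ≤ n * h := mul_le_mul_of_nonneg_right (by exact_mod_cast hi) h0
    simp only [hy]; linarith
  have hcA : ∀ i, c ∈ {t ∈ Icc c d | f t ≤ y i} := fun i => ⟨⟨le_rfl, hcd⟩, hyc i⟩
  have hbdd : ∀ i, BddAbove {t ∈ Icc c d | f t ≤ y i} := fun i => ⟨d, fun t ht => ht.1.2⟩
  have hτmem : ∀ i, τ i ∈ Icc c d := by
    intro i
    by_cases hi : i = 0
    · simp [hτ, hi, hcd]
    · simp only [hτ, hi, if_false]
      exact ⟨le_csSup (hbdd i) (hcA i), csSup_le ⟨c, hcA i⟩ fun t ht => ht.1.2⟩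
  have hτmono : Monotone τ := by
    intro i j hij
    by_cases hi : i = 0
    · have : τ i = c := by simp [hτ, hi]
      rw [this]
      exact (hτmem j).1
    · have hj : j ≠ 0 := by omega
      simp only [hτ, hi, hj, if_false]
      refine csSup_le_csSup (hbdd j) ⟨c, hcA i⟩ fun t ht => ⟨ht.1, ht.2.trans ?_⟩
      have : (i : ℝ) * h ≤ j * h := mul_le_mul_of_nonneg_right (by exact_mod_cast hij) h0
      simp only [hy]; linarith
  have hτ0 : τ 0 = c := by simp [hτ]
  have hτn : τ n = d := by
    refine le_antisymm (hτmem n).2 ?_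
    simp only [hτ, hn.ne', if_false]
    refine le_csSup (hbdd n) ⟨⟨hcd, le_rfl⟩, ?_⟩
    simp only [hy]; linarith
  have hdist : ∀ i ≤ n, |f (τ i) - y i| ^ p ≤ W (τ i) := by
    intro i hi
    by_cases h1 : i = 0
    · subst h1
      simp [hτ0, hy, Real.zero_rpow hp0.ne', hW]
    · simp only [hτ, h1, if_false]
      exact abs_sub_rpow_le_at_last_passage hcd hp0 hW hL hR (hyc i) (hyd i hi)
  set S := (Finset.range (n + 1)).image τ with hS
  have hSP : IsPartition c d S := by
    refine ⟨Finset.mem_image.2 ⟨0, by simp, hτ0⟩, Finset.mem_image.2 ⟨n, by simp, hτn⟩, ?_⟩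
    intro t ht
    obtain ⟨i, -, rfl⟩ := Finset.mem_image.1 ht
    exact hτmem i
  refine ⟨S, hSP, ?_⟩
  have step : chainSum (fun u v => |f v - f u| ^ p) S ≤
      chainSum (fun u v => 3 ^ p * (h ^ p + W u) + 3 ^ p * W v) S := by
    refine chainSum_le_chainSum hSP fun u hu v hv huv hno => ?_
    obtain ⟨i, -, hi⟩ := Finset.mem_image.1 hu
    obtain ⟨j, hj, hj'⟩ := Finset.mem_image.1 hv
    have hex : ∃ k, u < τ k := ⟨j, hj' ▸ huv⟩
    classical
    obtain ⟨k, hk, hkmin⟩ : ∃ k, u < τ k ∧ ∀ l < k, τ l ≤ u :=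
      ⟨Nat.find hex, Nat.find_spec hex, fun l hl => not_lt.1 (Nat.find_min hex hl)⟩
    have hkj : k ≤ j := by
      by_contra! hlt
      exact absurd (hkmin j hlt) (not_le.2 (hj' ▸ huv))
    have hik : i < k := by
      by_contra! hle
      exact absurd (hτmono hle) (not_le.2 (hi ▸ hk))
    have hjn : j ≤ n := by simpa [Nat.lt_succ_iff] using hj
    obtain ⟨k, rfl⟩ : ∃ l, k = l + 1 := ⟨k - 1, by omega⟩
    have hku : τ k = u :=
      le_antisymm (hkmin k (by omega)) (hi ▸ hτmono (by omega))
    have hkv : τ (k + 1) = v := by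
      have h1 : τ (k + 1) ≤ v := hj' ▸ hτmono hkj
      rcases h1.lt_or_eq with h2 | h2
      · exact absurd ⟨hk, h2⟩ (hno _ (Finset.mem_image.2 ⟨k + 1, by simp; omega, rfl⟩))
      · exact h2
    have d1 := hdist k (by omega)
    have d2 := hdist (k + 1) (by omega)
    rw [hku] at d1
    rw [hkv] at d2
    have hyy : y (k + 1) - y k = h := by simp only [hy]; push_cast; ring
    have tri : |f v - f u| ≤ h + |f u - y k| + |f v - y (k + 1)| := by
      have e : f v - f u = (f v - y (k + 1)) + h - (f u - y k) := by rw [← hyy]; ring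
      rw [e]
      refine (abs_sub _ _).trans ?_
      have := abs_add_le (f v - y (k + 1)) h
      rw [abs_of_nonneg h0] at this
      linarith
    calc |f v - f u| ^ p ≤ (h + |f u - y k| + |f v - y (k + 1)|) ^ p :=
          Real.rpow_le_rpow (abs_nonneg _) tri hp0.le
      _ ≤ 3 ^ p * (h ^ p + |f u - y k| ^ p + |f v - y (k + 1)| ^ p) :=
          add_add_rpow_le h0 (abs_nonneg _) (abs_nonneg _) hp0.le
      _ ≤ 3 ^ p * (h ^ p + W u + W v) :=
          mul_le_mul_of_nonneg_left (by linarith) h3.le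
      _ = _ := by ring
  rw [partSum_eq_chainSum]
  refine step.trans ?_
  rw [chainSum_add_right_left (fun u => 3 ^ p * (h ^ p + W u)) (fun v => 3 ^ p * W v) hSP]
  have hcard : (S.card : ℝ) ≤ n + 1 := by
    have : S.card ≤ (Finset.range (n + 1)).card := Finset.card_image_le
    rw [Finset.card_range] at this
    exact_mod_cast this
  have e : ∑ t ∈ S, (3 ^ p * (h ^ p + W t) + 3 ^ p * W t) =
      3 ^ p * (S.card * h ^ p) + 2 * 3 ^ p * ∑ t ∈ S, W t := by
    rw [Finset.mul_sum, ← nsmul_eq_mul, ← Finset.sum_const, Finset.mul_sum,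
      ← Finset.sum_add_distrib]
    exact Finset.sum_congr rfl fun t _ => by ring
  have hh0 : 0 ≤ h ^ p := Real.rpow_nonneg h0 p
  have i1 : 3 ^ p * (S.card * h ^ p) ≤ ε := by
    have : S.card * h ^ p ≤ ε / 3 ^ p :=
      (mul_le_mul_of_nonneg_right hcard hh0).trans hnε
    calc 3 ^ p * (S.card * h ^ p) ≤ 3 ^ p * (ε / 3 ^ p) := mul_le_mul_of_nonneg_left this h3.le
      _ = ε := by field_simp
  have i2 : 2 * 3 ^ p * ∑ t ∈ S, W t ≤ 2 * 3 ^ p * M :=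
    mul_le_mul_of_nonneg_left (hM S hSP.2.2) (by positivity)
  have i3 : 0 ≤ 3 ^ p * W c := mul_nonneg h3.le (hW c)
  have i4 : 0 ≤ 3 ^ p * (h ^ p + W d) := mul_nonneg h3.le (add_nonneg hh0 (hW d))
  rw [e]
  linarith

theorem partSum_neg (p : ℝ) (f : ℝ → ℝ) (S : Finset ℝ) :
    partSum p (fun t => -f t) S = partSum p f S := by
  unfold partSum
  refine Finset.sum_congr rfl fun i _ => ?_
  rw [neg_sub_neg, abs_sub_comm]

/-- A regulated function has partitions whose `p`-variation sum is controlled by the `p`-th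
powers of the jumps. -/
theorem exists_partition_partSum_le {f W : ℝ → ℝ} {c d p M ε : ℝ} (hcd : c ≤ d)
    (hp : 1 < p) (hW : ∀ t, 0 ≤ W t)
    (hL : ∀ t ∈ Ioc c d, ∃ l, Tendsto f (𝓝[<] t) (𝓝 l) ∧ |f t - l| ^ p ≤ W t)
    (hR : ∀ t ∈ Ico c d, ∃ r, Tendsto f (𝓝[>] t) (𝓝 r) ∧ |r - f t| ^ p ≤ W t)
    (hM : ∀ A : Finset ℝ, ↑A ⊆ Icc c d → ∑ t ∈ A, W t ≤ M) (hε : 0 < ε) :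
    ∃ S, IsPartition c d S ∧ partSum p f S ≤ 2 * 3 ^ p * M + ε := by
  rcases le_total (f c) (f d) with hf | hf
  · exact exists_partition_partSum_le_of_le hcd hp hW hL hR hM hε hf
  · obtain ⟨S, hS, hle⟩ := exists_partition_partSum_le_of_le (f := fun t => -f t) hcd hp hW
      (fun t ht => by
        obtain ⟨l, hl, hle⟩ := hL t ht
        exact ⟨-l, hl.neg, by rwa [neg_sub_neg, abs_sub_comm]⟩)
      (fun t ht => by
        obtain ⟨l, hl, hle⟩ := hR t ht
        exact ⟨-l, hl.neg, by rwa [neg_sub_neg, abs_sub_comm]⟩) hM hε (neg_le_neg hf)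
    exact ⟨S, hS, by rwa [partSum_neg] at hle⟩

/-- On a cell `[u,v]` the jumps at the endpoints enter an upper bound with constant one. -/
theorem exists_partition_partSum_le_endpoint_jumps {f W : ℝ → ℝ} {u v p r l M ε : ℝ}
    (huv : u < v) (hp : 1 < p) (hW : ∀ t, 0 ≤ W t)
    (hL : ∀ t ∈ Ioo u v, ∃ l, Tendsto f (𝓝[<] t) (𝓝 l) ∧ |f t - l| ^ p ≤ W t)
    (hR : ∀ t ∈ Ioo u v, ∃ r, Tendsto f (𝓝[>] t) (𝓝 r) ∧ |r - f t| ^ p ≤ W t)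
    (hr : Tendsto f (𝓝[>] u) (𝓝 r)) (hl : Tendsto f (𝓝[<] v) (𝓝 l))
    (hM : ∀ A : Finset ℝ, ↑A ⊆ Ioo u v → ∑ t ∈ A, W t ≤ M) (hε : 0 < ε) :
    ∃ S, IsPartition u v S ∧
      partSum p f S ≤ |r - f u| ^ p + |f v - l| ^ p + 2 * 3 ^ p * M + ε := by
  have hp0 : 0 ≤ p := by linarith
  have hr' : Tendsto (fun t => |f t - f u| ^ p) (𝓝[>] u) (𝓝 (|r - f u| ^ p)) :=
    (hr.sub_const _).abs.rpow_const (Or.inr hp0)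
  have hl' : Tendsto (fun t => |f v - f t| ^ p) (𝓝[<] v) (𝓝 (|f v - l| ^ p)) :=
    (hl.const_sub _).abs.rpow_const (Or.inr hp0)
  obtain ⟨c, hc, huc⟩ := ((hr'.eventually (gt_mem_nhds
    (lt_add_of_pos_right _ (by positivity : 0 < ε / 3)))).and (Ioo_mem_nhdsGT huv)).exists
  obtain ⟨d, hd, hcd⟩ := ((hl'.eventually (gt_mem_nhds
    (lt_add_of_pos_right _ (by positivity : 0 < ε / 3)))).and (Ioo_mem_nhdsLT huc.2)).exists
  obtain ⟨S, hS, hle⟩ := exists_partition_partSum_le (f := f) (W := W) (M := M) hcd.1.le hp hW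
    (fun t ht => hL t ⟨huc.1.trans ht.1, ht.2.trans_lt hcd.2⟩)
    (fun t ht => hR t ⟨huc.1.trans_le ht.1, ht.2.trans hcd.2⟩)
    (fun A hA => hM A fun t ht => ⟨huc.1.trans_le (hA ht).1, (hA ht).2.trans_lt hcd.2⟩)
    (by positivity : 0 < ε / 3)
  have hSd := hS.union (IsPartition.pair hcd.2)
  refine ⟨insert u (S ∪ {d, v}), hSd.insert_lt huc.1, ?_⟩
  rw [partSum_eq_chainSum] at hle ⊢
  rw [chainSum_insert _ hSd huc.1, chainSum_union _ hS (IsPartition.pair hcd.2),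
    chainSum_insert _ (IsPartition.singleton v) hcd.2, chainSum_singleton]
  linarith

/-- On a cell `[u,v]` the jumps at the endpoints bound all fine `p`-variation sums from below. -/
theorem exists_partition_endpoint_jumps_le_partSum {f : ℝ → ℝ} {u v p r l ε : ℝ}
    (huv : u < v) (hp : 0 ≤ p)
    (hr : Tendsto f (𝓝[>] u) (𝓝 r)) (hl : Tendsto f (𝓝[<] v) (𝓝 l)) (hε : 0 < ε) :
    ∃ K, IsPartition u v K ∧ ∀ S, IsPartition u v S → K ⊆ S →
      |r - f u| ^ p + |f v - l| ^ p - ε ≤ partSum p f S := by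
  have hr' : Tendsto (fun t => |f t - f u| ^ p) (𝓝[>] u) (𝓝 (|r - f u| ^ p)) :=
    (hr.sub_const _).abs.rpow_const (Or.inr hp)
  have hl' : Tendsto (fun t => |f v - f t| ^ p) (𝓝[<] v) (𝓝 (|f v - l| ^ p)) :=
    (hl.const_sub _).abs.rpow_const (Or.inr hp)
  obtain ⟨x, hx, hx'⟩ := (mem_nhdsGT_iff_exists_Ioc_subset).1 (hr'.eventually (lt_mem_nhds
    (sub_lt_self _ (by positivity : 0 < ε / 2))))
  obtain ⟨y, hy, hy'⟩ := (mem_nhdsLT_iff_exists_Ico_subset).1 (hl'.eventually (lt_mem_nhds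
    (sub_lt_self _ (by positivity : 0 < ε / 2))))
  obtain ⟨c, hc, hcv⟩ := exists_between (lt_min hx huv)
  obtain ⟨d, hd, hdv⟩ := exists_between (max_lt hy (hcv.trans_le (min_le_right x v)))
  have hcx : c < x := hcv.trans_le (min_le_left x v)
  have hyd : y < d := (le_max_left y c).trans_lt hd
  have hcd : c < d := (le_max_right y c).trans_lt hd
  have hK := ((IsPartition.pair hdv).insert_lt hcd).insert_lt hc
  refine ⟨_, hK, fun S hS hKS => ?_⟩
  rw [partSum_eq_chainSum]
  obtain ⟨m, T, hum, hT, rfl, e⟩ :=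
    exists_first_step_eq_chainSum (fun u v => |f v - f u| ^ p) hS huv
  have hcT : c ∈ T := by
    have : c ∈ insert u T := hKS (by simp)
    exact (Finset.mem_insert.1 this).resolve_left hc.ne'
  have hdT : d ∈ T := by
    have : d ∈ insert u T := hKS (by simp)
    exact (Finset.mem_insert.1 this).resolve_left (hc.trans hcd).ne'
  obtain ⟨w, hw, hwle⟩ := exists_last_step_le_chainSum (g := fun u v => |f v - f u| ^ p)
    (fun _ _ => by positivity) hT hdT hdv
  have h1 : |r - f u| ^ p - ε / 2 < |f m - f u| ^ p :=
    hx' ⟨hum, (hT.2.2 hcT).1.trans hcx.le⟩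
  have h2 : |f v - l| ^ p - ε / 2 < |f v - f w| ^ p := hy' ⟨hyd.le.trans hw.1, hw.2⟩
  rw [e]
  linarith

/-- The total mass of `W` on `(-∞, t]`. -/
noncomputable def massIic (W : ℝ → ℝ) (t : ℝ) : ℝ := ∑' s, (Iic t).indicator W s

theorem sum_le_massIic_sub {W : ℝ → ℝ} (hW : ∀ t, 0 ≤ W t) (hs : Summable W) {u v : ℝ}
    (huv : u < v) {A : Finset ℝ} (hA : ↑A ⊆ Ioo u v) :
    ∑ t ∈ A, W t ≤ massIic W v - W v - massIic W u := by
  have h1 : (Iic v).indicator W = fun s => (Iic u).indicator W s + (Ioc u v).indicator W s := by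
    rw [← Iic_union_Ioc_eq_Iic huv.le]
    exact Set.indicator_union_of_disjoint (Set.Iic_disjoint_Ioc le_rfl) W
  have h2 : massIic W v = massIic W u + ∑' s, (Ioc u v).indicator W s := by
    rw [massIic, h1, (hs.indicator _).tsum_add (hs.indicator _), massIic]
  have hv : v ∉ A := fun h => lt_irrefl _ (hA h).2
  have h3 : ∑ t ∈ insert v A, (Ioc u v).indicator W t ≤ ∑' s, (Ioc u v).indicator W s :=
    (hs.indicator _).sum_le_tsum _ fun t _ => Set.indicator_nonneg (fun t _ => hW t) t
  have h4 : ∑ t ∈ insert v A, (Ioc u v).indicator W t = W v + ∑ t ∈ A, W t := by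
    rw [Finset.sum_insert hv, Set.indicator_of_mem (by simp [huv])]
    congr 1
    exact Finset.sum_congr rfl fun t ht =>
      Set.indicator_of_mem (Ioo_subset_Ioc_self (hA ht)) W
  linarith

/-- if `f` is regulated on `[a,b]`, `1 < p`, and the jump sum
`σ_p(f)` converges, then every partition admits refinements whose `p`-variation sums
come within `ε` of `σ_p(f)`; consequently `sup_κ inf_{λ ⊇ κ} s_p(f;λ) = σ_p(f)`. -/
theorem refinement_sums_eq_jump_sum (a b : ℝ) (hab : a < b) (f : ℝ → ℝ) (p : ℝ) (hp : 1 < p)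
    (hleft : ∀ t ∈ Set.Ioc a b, Tendsto f (𝓝[<] t) (𝓝 (leftLim f t)))
    (hright : ∀ t ∈ Set.Ico a b, Tendsto f (𝓝[>] t) (𝓝 (rightLim f t)))
    (hsl : Summable fun t : Set.Ioc a b => |f ↑t - leftLim f ↑t| ^ p)
    (hsr : Summable fun t : Set.Ico a b => |rightLim f ↑t - f ↑t| ^ p)
    (σp : ℝ)
    (hσ : σp = (∑' t : Set.Ioc a b, |f ↑t - leftLim f ↑t| ^ p) +
        ∑' t : Set.Ico a b, |rightLim f ↑t - f ↑t| ^ p) :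
    (∀ κ : Finset ℝ, IsPartition a b κ → ∀ ε > 0, ∃ lam : Finset ℝ,
        IsPartition a b lam ∧ κ ⊆ lam ∧ partSum p f lam ≤ σp + ε) ∧
    sSup {x : ℝ | ∃ κ : Finset ℝ, IsPartition a b κ ∧
        x = sInf {y : ℝ | ∃ lam : Finset ℝ,
          IsPartition a b lam ∧ κ ⊆ lam ∧ y = partSum p f lam}} = σp := by
  set L : ℝ → ℝ := (Ioc a b).indicator fun t => |f t - leftLim f t| ^ p with hLdef
  set R : ℝ → ℝ := (Ico a b).indicator fun t => |rightLim f t - f t| ^ p with hRdef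
  have hL0 : ∀ t, 0 ≤ L t := Set.indicator_nonneg fun t _ => by positivity
  have hR0 : ∀ t, 0 ≤ R t := Set.indicator_nonneg fun t _ => by positivity
  have hLs : Summable L := summable_subtype_iff_indicator.1 hsl
  have hRs : Summable R := summable_subtype_iff_indicator.1 hsr
  set W : ℝ → ℝ := fun t => R t + L t with hWdef
  have hW0 : ∀ t, 0 ≤ W t := fun t => add_nonneg (hR0 t) (hL0 t)
  have hWs : Summable W := hRs.add hLs
  have hWout : ∀ t, t ∉ Icc a b → W t = 0 := fun t ht => by
    have h1 : t ∉ Ioc a b := fun h => ht (Ioc_subset_Icc_self h)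
    have h2 : t ∉ Ico a b := fun h => ht (Ico_subset_Icc_self h)
    simp [hWdef, hLdef, hRdef, Set.indicator_of_notMem h1, Set.indicator_of_notMem h2]
  have hσW : σp = ∑' t, W t := by
    rw [hσ, hRs.tsum_add hLs, add_comm]
    exact congrArg₂ _ (tsum_subtype (Ico a b) fun t => |rightLim f t - f t| ^ p)
      (tsum_subtype (Ioc a b) fun t => |f t - leftLim f t| ^ p)
  have hLeq : ∀ t ∈ Ioc a b, L t = |f t - leftLim f t| ^ p := fun t ht =>
    Set.indicator_of_mem ht _
  have hReq : ∀ t ∈ Ico a b, R t = |rightLim f t - f t| ^ p := fun t ht =>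
    Set.indicator_of_mem ht _
  have hLa : L a = 0 := Set.indicator_of_notMem (by simp) _
  have hRb : R b = 0 := Set.indicator_of_notMem (by simp) _
  have hFb : massIic W b = σp := by
    rw [hσW, massIic]
    refine tsum_congr fun t => ?_
    by_cases ht : t ∈ Iic b
    · exact Set.indicator_of_mem ht W
    · rw [Set.indicator_of_notMem ht, hWout t fun h => ht h.2]
  have hFa : massIic W a = W a := by
    rw [massIic, tsum_eq_single a, Set.indicator_of_mem (by simp)]
    intro t hta
    by_cases ht : t ∈ Iic a
    · rw [Set.indicator_of_mem ht, hWout t fun h => hta (le_antisymm ht h.1)]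
    · exact Set.indicator_of_notMem ht W
  have hba : 0 < b - a := sub_pos.2 hab
  have hfine : ∀ κ : Finset ℝ, IsPartition a b κ → ∀ δ > 0, ∃ T, IsPartition a b T ∧ κ ⊆ T ∧
      σp - δ ≤ ∑ t ∈ T, W t := by
    intro κ hκ δ hδ
    obtain ⟨T, hT⟩ := (hWs.hasSum.eventually (lt_mem_nhds (sub_lt_self _ hδ))).exists
    refine ⟨κ ∪ T.filter (· ∈ Icc a b), ⟨by simp [hκ.1], by simp [hκ.2.1], ?_⟩,
      Finset.subset_union_left, ?_⟩
    · intro t ht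
      rcases Finset.mem_union.1 ht with ht | ht
      · exact hκ.2.2 ht
      · exact (Finset.mem_filter.1 ht).2
    · rw [hσW]
      refine hT.le.trans ?_
      have e : ∑ t ∈ T, W t = ∑ t ∈ T.filter (· ∈ Icc a b), W t :=
        (Finset.sum_filter_of_ne fun t _ h => by
          by_contra hn
          exact h (hWout t hn)).symm
      rw [e]
      exact Finset.sum_le_sum_of_subset_of_nonneg Finset.subset_union_right fun t _ _ => hW0 t
  have upper : ∀ κ : Finset ℝ, IsPartition a b κ → ∀ ε > 0, ∃ lam : Finset ℝ,
      IsPartition a b lam ∧ κ ⊆ lam ∧ partSum p f lam ≤ σp + ε := by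
    intro κ hκ ε hε
    set C : ℝ := 2 * 3 ^ p with hC
    have hC0 : 0 < C := by positivity
    set η := ε / 2 / (b - a) with hη
    have hη0 : 0 < η := by positivity
    obtain ⟨S, hS, hκS, hSW⟩ := hfine κ hκ (ε / 2 / C) (by positivity)
    obtain ⟨T, hT, hST, hle⟩ := exists_refinement_chainSum_le
      (g := fun u v => |f v - f u| ^ p)
      (g' := fun u v => (R u - C * massIic W u - η * u) +
        (L v + C * massIic W v - C * W v + η * v)) (fun u v hau huv hvb => by
        have hu : u ∈ Ico a b := ⟨hau, huv.trans_le hvb⟩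
        have hv : v ∈ Ioc a b := ⟨hau.trans_lt huv, hvb⟩
        obtain ⟨T, hT, hle⟩ := exists_partition_partSum_le_endpoint_jumps (f := f) (W := W)
          (ε := η * (v - u)) huv hp hW0
          (fun t ht => by
            have h1 : t ∈ Ioc a b := ⟨hau.trans_lt ht.1, ht.2.le.trans hvb⟩
            refine ⟨_, hleft t h1, ?_⟩
            rw [← hLeq t h1]
            exact le_add_of_nonneg_left (hR0 t))
          (fun t ht => by
            have h1 : t ∈ Ico a b := ⟨hau.trans ht.1.le, ht.2.trans_le hvb⟩
            refine ⟨_, hright t h1, ?_⟩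
            rw [← hReq t h1]
            exact le_add_of_nonneg_right (hL0 t))
          (hright u hu) (hleft v hv) (fun A hA => sum_le_massIic_sub hW0 hWs huv hA)
          (mul_pos hη0 (sub_pos.2 huv))
        refine ⟨T, hT, ?_⟩
        rw [← hReq u hu, ← hLeq v hv, partSum_eq_chainSum] at hle
        refine hle.trans (le_of_eq ?_)
        ring) hS
    refine ⟨T, hT, hκS.trans hST, ?_⟩
    rw [partSum_eq_chainSum]
    refine hle.trans ?_
    rw [chainSum_add_right_left (fun u => R u - C * massIic W u - η * u)
      (fun v => L v + C * massIic W v - C * W v + η * v) hS, hFa, hFb, hLa, hRb]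
    have e : ∑ t ∈ S, (R t - C * massIic W t - η * t +
        (L t + C * massIic W t - C * W t + η * t)) = ∑ t ∈ S, W t - C * ∑ t ∈ S, W t := by
      rw [Finset.mul_sum, ← Finset.sum_sub_distrib]
      exact Finset.sum_congr rfl fun t _ => by simp only [hWdef]; ring
    have h1 : ∑ t ∈ S, W t ≤ σp := by
      rw [hσW]
      exact hWs.sum_le_tsum _ fun t _ => hW0 t
    have h2 : C * (σp - ∑ t ∈ S, W t) ≤ ε / 2 := by
      calc C * (σp - ∑ t ∈ S, W t) ≤ C * (ε / 2 / C) :=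
            mul_le_mul_of_nonneg_left (by linarith) hC0.le
        _ = ε / 2 := by field_simp
    have h3 : η * (b - a) = ε / 2 := by rw [hη]; field_simp
    rw [e]
    linarith
  have lower : ∀ ε > 0, ∃ K, IsPartition a b K ∧ ∀ T, IsPartition a b T → K ⊆ T →
      σp - ε ≤ partSum p f T := by
    intro ε hε
    set η := ε / 2 / (b - a) with hη
    have hη0 : 0 < η := by positivity
    obtain ⟨S, hS, -, hSW⟩ := hfine _ (IsPartition.pair hab) (ε / 2) (by positivity)
    obtain ⟨K, hK, hle⟩ := exists_refinement_le_chainSum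
      (g := fun u v => |f v - f u| ^ p)
      (g' := fun u v => (R u + η * u) + (L v - η * v)) (fun u v hau huv hvb => by
        have hu : u ∈ Ico a b := ⟨hau, huv.trans_le hvb⟩
        have hv : v ∈ Ioc a b := ⟨hau.trans_lt huv, hvb⟩
        obtain ⟨K, hK, hle⟩ := exists_partition_endpoint_jumps_le_partSum (p := p) huv
          (by linarith) (hright u hu) (hleft v hv) (mul_pos hη0 (sub_pos.2 huv))
        refine ⟨K, hK, fun T hT hKT => ?_⟩
        have := hle T hT hKT
        rw [← hReq u hu, ← hLeq v hv, partSum_eq_chainSum] at this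
        refine le_trans (le_of_eq ?_) this
        ring) hS
    refine ⟨K, hK, fun T hT hKT => ?_⟩
    rw [partSum_eq_chainSum]
    refine le_trans ?_ (hle T hT hKT)
    rw [chainSum_add_right_left (fun u => R u + η * u) (fun v => L v - η * v) hS, hLa, hRb]
    have e : ∑ t ∈ S, (R t + η * t + (L t - η * t)) = ∑ t ∈ S, W t :=
      Finset.sum_congr rfl fun t _ => by simp only [hWdef]; ring
    have h3 : η * (b - a) = ε / 2 := by rw [hη]; field_simp
    rw [e]
    linarith
  refine ⟨upper, ?_⟩
  have hinf : ∀ κ, IsPartition a b κ → sInf {y : ℝ | ∃ lam : Finset ℝ,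
      IsPartition a b lam ∧ κ ⊆ lam ∧ y = partSum p f lam} ≤ σp := by
    intro κ hκ
    refine le_of_forall_pos_le_add fun ε hε => ?_
    obtain ⟨lam, h1, h2, h3⟩ := upper κ hκ ε hε
    refine csInf_le_of_le ⟨0, ?_⟩ ⟨lam, h1, h2, rfl⟩ h3
    rintro y ⟨lam, -, -, rfl⟩
    exact chainSum_nonneg (g := fun u v => |f v - f u| ^ p) (fun _ _ => by positivity) lam
  apply le_antisymm
  · refine csSup_le ⟨_, {a, b}, IsPartition.pair hab, rfl⟩ ?_
    rintro x ⟨κ, hκ, rfl⟩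
    exact hinf κ hκ
  · refine le_of_forall_pos_le_add fun ε hε => ?_
    obtain ⟨K, hK, hle⟩ := lower ε hε
    rw [← sub_le_iff_le_add]
    refine le_csSup_of_le ⟨σp, ?_⟩ ⟨K, hK, rfl⟩ (le_csInf ⟨_, K, hK, le_rfl, rfl⟩ ?_)
    · rintro x ⟨κ, hκ, rfl⟩
      exact hinf κ hκ
    · rintro y ⟨lam, h1, h2, rfl⟩
      exact hle lam h1 h2
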